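/- For all n, k ≥ 1 and every minimal k-factorization f ∈ F_n^k, the integers semiarea_k(f) and cosemiarea_k(f) are both divisible by k. -/

import Mathlib

/-- A rooted forest on vertex set `V`, encoded by its parent function:
`parent v = some u` means `u` is the parent of `v` (edges are directed away from
the roots, so `(u,v)` is an edge), and `parent v = none` means `v` is a root.
Acyclicity guarantees that every connected component is a tree with a
distinguished root. -/
structure RootedForest (V : Type) where
  parent : V → Option V
  acyclic : ∀ v : V, ¬ Relation.TransGen (fun a b : V => parent a = some b) v v

namespace RootedForest

variable {V : Type} [Fintype V] [LinearOrder V]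

/-- `F.Desc u v` means `v` is a (strict) descendant of `u`. -/
def Desc (F : RootedForest V) (u v : V) : Prop :=
  Relation.TransGen (fun a b : V => F.parent a = some b) v u

/-- The hook of `u`: `u` together with all of its descendants. -/
def hook (F : RootedForest V) (u : V) : Set V := {v : V | v = u ∨ F.Desc u v}

/-- The hook length `h(u)`. -/
noncomputable def h (F : RootedForest V) (u : V) : ℕ := (F.hook u).ncard

/-- The left hook length `h_L(u)`: sum of hook lengths of children smaller than `u`. -/
noncomputable def hL (F : RootedForest V) (u : V) : ℕ :=
  ∑ v ∈ Finset.univ.filter (fun v : V => F.parent v = some u ∧ v < u), F.h v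

/-- The right hook length `h_R(u)`: sum of hook lengths of children larger than `u`. -/
noncomputable def hR (F : RootedForest V) (u : V) : ℕ :=
  ∑ v ∈ Finset.univ.filter (fun v : V => F.parent v = some u ∧ u < v), F.h v

/-- The major index of a rooted forest. -/
noncomputable def maj (F : RootedForest V) : ℕ := ∑ u : V, F.hL u

/-- The comajor index of a rooted forest. -/
noncomputable def comaj (F : RootedForest V) : ℕ := ∑ u : V, F.hR u

/-- The number of inversions: pairs `(u,v)` with `v` a descendant of `u` and `v < u`. -/
noncomputable def inv (F : RootedForest V) : ℕ :=
  {p : V × V | F.Desc p.1 p.2 ∧ p.2 < p.1}.ncard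

/-- The number of coinversions: pairs `(u,v)` with `v` a descendant of `u` and `v > u`. -/
noncomputable def coinv (F : RootedForest V) : ℕ :=
  {p : V × V | F.Desc p.1 p.2 ∧ p.1 < p.2}.ncard

/-- The number of connected components (= number of roots). -/
def comps (F : RootedForest V) : ℕ :=
  (Finset.univ.filter (fun v : V => F.parent v = none)).card

end RootedForest

/-- A `k`-forest on vertex set `Fin n` (vertices `1,…,n`): a rooted forest together with a
colour in `{0,…,k-1}` on each edge.  The colour of the edge `(parent v, v)` is recorded
at the vertex `v`; roots carry the dummy colour `0`. -/
structure KForest (n k : ℕ) extends RootedForest (Fin n) where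
  colour : Fin n → ℕ
  colour_lt : ∀ v, colour v < k
  colour_root : ∀ v, parent v = none → colour v = 0

namespace KForest

variable {n k : ℕ}

/-- The chromatic depth `chr_k(F) = ∑_{(u,v) ∈ E(F)} κ(u,v)·h(v)`. -/
noncomputable def chr (F : KForest n k) : ℕ :=
  ∑ v ∈ Finset.univ.filter (fun v : Fin n => F.parent v ≠ none),
    F.colour v * F.toRootedForest.h v

/-- The chromatic codepth `cochr_k(F) = ∑_{(u,v) ∈ E(F)} (k-1-κ(u,v))·h(v)`. -/
noncomputable def cochr (F : KForest n k) : ℕ :=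
  ∑ v ∈ Finset.univ.filter (fun v : Fin n => F.parent v ≠ none),
    (k - 1 - F.colour v) * F.toRootedForest.h v

/-- `maj_k = maj + chr_k`. -/
noncomputable def majk (F : KForest n k) : ℕ := F.toRootedForest.maj + F.chr

/-- `comaj_k = comaj + cochr_k`. -/
noncomputable def comajk (F : KForest n k) : ℕ := F.toRootedForest.comaj + F.cochr

/-- `inv_k = inv + chr_k`. -/
noncomputable def invk (F : KForest n k) : ℕ := F.toRootedForest.inv + F.chr

/-- `coinv_k = coinv + cochr_k`. -/
noncomputable def coinvk (F : KForest n k) : ℕ := F.toRootedForest.coinv + F.cochr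

end KForest

/-- A minimal factorization of the long cycle `(0 1 ⋯ n)` on `{0,1,…,n}` into `n`
transpositions `(aᵢ bᵢ)` with `aᵢ < bᵢ`, multiplied left to right (the leftmost factor
is applied first, which corresponds to the reversed product in Mathlib's convention). -/
structure MinFact (n : ℕ) where
  a : Fin n → Fin (n+1)
  b : Fin n → Fin (n+1)
  ab_lt : ∀ i, a i < b i
  prod_eq : (List.ofFn (fun i => Equiv.swap (a i) (b i))).reverse.prod = finRotate (n+1)

namespace MinFact

variable {n : ℕ}

/-- `area(f) = C(n,2) - ∑ aᵢ`. -/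
def area (f : MinFact n) : ℤ := (n.choose 2 : ℤ) - ∑ i : Fin n, ((f.a i : ℕ) : ℤ)

/-- `coarea(f) = ∑ (bᵢ - 1) - C(n,2)`. -/
def coarea (f : MinFact n) : ℤ :=
  (∑ i : Fin n, (((f.b i : ℕ) : ℤ) - 1)) - (n.choose 2 : ℤ)

end MinFact

/-- A minimal `k`-factorization of the long cycle `(0 1 ⋯ kn)` on `{0,1,…,kn}` into `n`
cycles of length `k+1`: the `j`-th factor is the cycle `(a j 0, a j 1, …, a j k)`
(sending `a j 0 ↦ a j 1 ↦ ⋯ ↦ a j k ↦ a j 0`), presented with its least element first,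
and the factors are multiplied left to right (leftmost applied first). -/
structure MinKFact (n k : ℕ) where
  a : Fin n → Fin (k+1) → Fin (k*n+1)
  inj : ∀ j, Function.Injective (a j)
  min_first : ∀ j i, a j 0 ≤ a j i
  prod_eq :
    (List.ofFn (fun j => (List.ofFn (a j)).formPerm)).reverse.prod = finRotate (k*n+1)

namespace MinKFact

variable {n k : ℕ}

/-- `area_k(f) = C(kn,2) - n·C(k,2) - k·∑_j a_j^0`. -/
def areak (f : MinKFact n k) : ℤ :=
  ((k*n).choose 2 : ℤ) - n * (k.choose 2 : ℤ) - k * ∑ j : Fin n, ((f.a j 0 : ℕ) : ℤ)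

/-- `coarea_k(f) = k·∑_j (a_j^k - 1) - C(kn,2) - n·C(k,2)`. -/
def coareak (f : MinKFact n k) : ℤ :=
  k * (∑ j : Fin n, (((f.a j (Fin.last k) : ℕ) : ℤ) - 1))
    - ((k*n).choose 2 : ℤ) - n * (k.choose 2 : ℤ)

/-- `semiarea_k(f) = C(kn,2) - ∑_{i=0}^{k-1} ∑_j a_j^i`. -/
def semiareak (f : MinKFact n k) : ℤ :=
  ((k*n).choose 2 : ℤ) - ∑ i : Fin k, ∑ j : Fin n, ((f.a j i.castSucc : ℕ) : ℤ)

/-- `cosemiarea_k(f) = ∑_{i=1}^{k} ∑_j (a_j^i - 1) - C(kn,2)`. -/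
def cosemiareak (f : MinKFact n k) : ℤ :=
  (∑ i : Fin k, ∑ j : Fin n, (((f.a j i.succ : ℕ) : ℤ) - 1)) - ((k*n).choose 2 : ℤ)

end MinKFact

/-- `p` is a `k`-parking function: its nondecreasing rearrangement `b = p ∘ sort p`
satisfies `b i ≤ k * i` (with 0-indexed `i`, matching `bᵢ ≤ k(i-1)` for 1-indexed `i`). -/
def IsParkingFunction (k : ℕ) {n : ℕ} (p : Fin n → ℕ) : Prop :=
  ∀ i : Fin n, p (Tuple.sort p i) ≤ k * i

/-- The displacement `disp_k(p) = k·C(n,2) - ∑ᵢ aᵢ` of a `k`-parking function. -/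
def dispk (k : ℕ) {n : ℕ} (p : Fin n → ℕ) : ℤ :=
  k * (n.choose 2 : ℤ) - ∑ i : Fin n, (p i : ℤ)

open Finset in
/-- Growth lemma: a connected class of a hypergraph with edges of size at most `k+1`
has at most `1 + k * (number of edges meeting it)` vertices. -/
lemma class_card_le {V ι : Type} [Fintype V] [DecidableEq V] [Fintype ι] [DecidableEq ι]
    (k : ℕ) (E : ι → Finset V) (hE : ∀ j, (E j).card ≤ k + 1)
    {Q : Type} [DecidableEq Q] (q : V → Q)
    (hq : ∀ j, ∀ x ∈ E j, ∀ y ∈ E j, q x = q y)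
    (hconn : ∀ T : Finset V, (∀ j, ∀ x ∈ E j, ∀ y ∈ E j, x ∈ T → y ∈ T) →
      ∀ x y, q x = q y → x ∈ T → y ∈ T) (x : V) :
    (univ.filter (fun y => q y = q x)).card ≤
      1 + k * (univ.filter (fun j => ∃ y ∈ E j, q y = q x)).card := by
  set S := univ.filter (fun y => q y = q x) with hS
  set L := univ.filter (fun j => ∃ y ∈ E j, q y = q x) with hL
  have main : ∀ t : ℕ, ∃ (U : Finset ι) (T : Finset V), U ⊆ L ∧ T ⊆ S ∧ x ∈ T ∧
      T.card ≤ 1 + k * U.card ∧ (∀ j ∈ U, E j ⊆ T) ∧ (T = S ∨ t ≤ U.card) := by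
    intro t
    induction t with
    | zero =>
      exact ⟨∅, {x}, by simp, by simp [hS], by simp, by simp, by simp, Or.inr (by simp)⟩
    | succ t ih =>
      obtain ⟨U, T, hU, hT, hx, hc, hUT, hor⟩ := ih
      by_cases hTS : T = S
      · exact ⟨U, T, hU, hT, hx, hc, hUT, Or.inl hTS⟩
      have hor : t ≤ U.card := hor.resolve_left hTS
      have hex : ∃ j, ∃ u ∈ E j, ∃ v ∈ E j, u ∈ T ∧ v ∉ T := by
        by_contra hno
        push Not at hno
        apply hTS
        apply Finset.Subset.antisymm hT
        intro y hy
        refine hconn T hno x y ?_ hx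
        simp only [hS, mem_filter, mem_univ, true_and] at hy
        exact hy.symm
      obtain ⟨j, u, hu, v, hv, huT, hvT⟩ := hex
      have hjU : j ∉ U := fun h => hvT (hUT j h hv)
      have huS : q u = q x := by
        have := hT huT
        simpa [hS] using this
      refine ⟨insert j U, T ∪ E j, ?_, ?_, ?_, ?_, ?_, ?_⟩
      · intro i hi
        rcases Finset.mem_insert.1 hi with rfl | hi
        · simp only [hL, mem_filter, mem_univ, true_and]
          exact ⟨u, hu, huS⟩
        · exact hU hi
      · intro y hy
        rcases Finset.mem_union.1 hy with hy | hy
        · exact hT hy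
        · simp only [hS, mem_filter, mem_univ, true_and]
          rw [← huS]
          exact hq j y hy u hu
      · exact Finset.mem_union_left _ hx
      · have h1 := Finset.card_union_add_card_inter T (E j)
        have h2 : 1 ≤ (T ∩ E j).card :=
          Finset.card_pos.2 ⟨u, Finset.mem_inter.2 ⟨huT, hu⟩⟩
        have h3 := hE j
        rw [Finset.card_insert_of_notMem hjU, mul_add]
        omega
      · intro i hi
        rcases Finset.mem_insert.1 hi with rfl | hi
        · exact Finset.subset_union_right
        · exact (hUT i hi).trans Finset.subset_union_left
      · right
        rw [Finset.card_insert_of_notMem hjU]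
        omega
  obtain ⟨U, T, hU, hT, hx, hc, hUT, hor⟩ := main (L.card + 1)
  have hUL := Finset.card_le_card hU
  have : T = S := by
    rcases hor with h | h
    · exact h
    · omega
  rw [this] at hc
  exact hc.trans (by gcongr)

open Finset in
/-- Hypertree count. -/
lemma hypertree_count {V ι : Type} [Fintype V] [DecidableEq V] [Fintype ι] [DecidableEq ι]
    (k : ℕ) (E : ι → Finset V) (hE : ∀ j, (E j).card ≤ k + 1)
    {Q : Type} [Fintype Q] [DecidableEq Q] (q : V → Q) (hqs : Function.Surjective q)
    (hq : ∀ j, ∀ x ∈ E j, ∀ y ∈ E j, q x = q y)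
    (hconn : ∀ T : Finset V, (∀ j, ∀ x ∈ E j, ∀ y ∈ E j, x ∈ T → y ∈ T) →
      ∀ x y, q x = q y → x ∈ T → y ∈ T)
    (hV : Fintype.card V = k + 1 + k * Fintype.card ι)
    (hQ : Fintype.card Q ≤ k + 1) :
    Fintype.card Q = k + 1 ∧ ∀ c : Q, ∃ m : ℕ,
      (univ.filter (fun y => q y = c)).card = 1 + k * m := by
  have h1 : ∀ c : Q, (univ.filter (fun y => q y = c)).card ≤
      1 + k * (univ.filter (fun j => ∃ y ∈ E j, q y = c)).card := by
    intro c
    obtain ⟨x, rfl⟩ := hqs c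
    exact class_card_le k E hE q hq hconn x
  have h2 : ∑ c : Q, (univ.filter (fun y => q y = c)).card = Fintype.card V := by
    rw [← Finset.card_univ]
    exact (Finset.card_eq_sum_card_fiberwise (fun _ _ => by simp)).symm
  have h3 : ∑ c : Q, (univ.filter (fun j => ∃ y ∈ E j, q y = c)).card ≤ Fintype.card ι := by
    simp_rw [Finset.card_filter]
    rw [Finset.sum_comm]
    calc _ ≤ ∑ j : ι, 1 := by
          apply Finset.sum_le_sum
          intro j _
          rw [← Finset.card_filter, Finset.card_le_one]
          intro c hc d hd
          simp only [mem_filter, mem_univ, true_and] at hc hd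
          obtain ⟨y, hy, rfl⟩ := hc
          obtain ⟨z, hz, rfl⟩ := hd
          exact hq j y hy z hz
      _ = _ := by simp
  have h4 : ∑ c : Q, (1 + k * (univ.filter (fun j => ∃ y ∈ E j, q y = c)).card) =
      Fintype.card Q + k * ∑ c : Q, (univ.filter (fun j => ∃ y ∈ E j, q y = c)).card := by
    rw [Finset.sum_add_distrib, ← Finset.mul_sum]
    simp
  have h5 := Nat.mul_le_mul_left k h3
  have h6 := Finset.sum_le_sum (fun c (_ : c ∈ (univ : Finset Q)) => h1 c)
  have h7 : Fintype.card Q = k + 1 := by omega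
  refine ⟨h7, ?_⟩
  have h8 := (Finset.sum_eq_sum_iff_of_le (fun c (_ : c ∈ (univ : Finset Q)) => h1 c)).1 (by omega)
  exact fun c => ⟨_, h8 c (mem_univ c)⟩

open Finset in
/-- Labels along the circle. -/
lemma circle_labels (k N : ℕ) (a : Fin (k+1) → Fin (N+1)) (hinj : Function.Injective a)
    (hmin : ∀ i, a 0 ≤ a i) (c : Fin (N+1) → Fin (k+1)) (hca : ∀ i, c (a i) = i)
    (h1 : ∀ x, (∀ i, a i ≠ x + 1) → c x = c (x+1))
    (h2 : ∀ x, ∀ i : Fin k, a i.succ = x + 1 → c x = i.castSucc) (i : Fin k) :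
    (a i.succ : ℕ) = a i.castSucc + (univ.filter (fun y => c y = i.castSucc)).card := by
  have hval : ∀ x : ℕ, (h : x + 1 < N + 1) →
      (⟨x, by omega⟩ : Fin (N+1)) + 1 = ⟨x+1, h⟩ := by
    intro x h
    ext
    rw [Fin.val_add_one_of_lt]
    rw [Fin.lt_def]
    simp
    omega
  have up : ∀ x : ℕ, (a 0 : ℕ) ≤ x → ∀ h : x < N + 1, ∀ i : Fin (k+1),
      (i ≤ c ⟨x, h⟩ ↔ (a i : ℕ) ≤ x) := by
    intro x hx
    induction x, hx using Nat.le_induction with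
    | base =>
      intro h i
      have e : (⟨(a 0 : ℕ), h⟩ : Fin (N+1)) = a 0 := rfl
      rw [e, hca]
      constructor
      · intro hi
        have : i = 0 := Fin.le_zero_iff.1 hi
        rw [this]
      · intro hi
        have : a i = a 0 := le_antisymm hi (hmin i)
        rw [hinj this]
    | succ x hx ih =>
      intro h i
      have ih := ih (by omega)
      have hv := hval x h
      by_cases hr : ∃ j, a j = ⟨x+1, h⟩
      · obtain ⟨j, hj⟩ := hr
        rw [← hj, hca]
        rcases Fin.eq_zero_or_eq_succ j with rfl | ⟨l, rfl⟩
        · have := congrArg Fin.val hj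
          simp at this
          omega
        · have hc := h2 ⟨x, by omega⟩ l (by rw [hj, hv])
          rw [hc] at ih
          have ihi := ih i
          constructor
          · intro hi
            rcases lt_or_eq_of_le hi with hi | hi
            · have : i ≤ l.castSucc := by
                rw [Fin.lt_def] at hi; rw [Fin.le_def]; simp at hi ⊢; omega
              have := ihi.1 this
              omega
            · rw [hi, hj]
          · intro hi
            rcases Nat.lt_or_ge x (a i) with hlt | hge
            · have : a i = a l.succ := by
                rw [hj]; ext; simp; omega
              rw [hinj this]
            · have := ihi.2 hge
              rw [Fin.le_def] at this ⊢; simp at this ⊢; omega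
      · push Not at hr
        have hc := h1 ⟨x, by omega⟩ (by intro i; rw [hv]; exact hr i)
        rw [hv] at hc
        rw [← hc, ih i]
        have : (a i : ℕ) ≠ x + 1 := fun hh => hr i (Fin.ext hh)
        omega
  have low : ∀ x : ℕ, x < (a 0 : ℕ) → ∀ h : x < N + 1, c ⟨x, h⟩ = Fin.last k := by
    intro x
    induction x with
    | zero =>
      intro hx h
      have e : Fin.last N + 1 = (⟨0, h⟩ : Fin (N+1)) := by simp
      have := h1 (Fin.last N) (by
        intro i hi
        rw [e] at hi
        have h3 := hmin i
        rw [hi, Fin.le_def] at h3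
        simp at h3
        simp [h3] at hx)
      rw [e] at this
      rw [← this]
      apply le_antisymm (Fin.le_last _)
      have := (up N (by omega) (by omega) (Fin.last k)).2 (by omega)
      exact this
    | succ x ih =>
      intro hx h
      have := h1 ⟨x, by omega⟩ (by
        intro i hi
        rw [hval x h] at hi
        have h3 := hmin i
        rw [hi, Fin.le_def] at h3
        simp at h3
        omega)
      rw [hval x h] at this
      rw [← this]
      exact ih (by omega) (by omega)
  have hset : univ.filter (fun y => c y = i.castSucc) = Finset.Ico (a i.castSucc) (a i.succ) := by
    ext y
    simp only [mem_filter, mem_univ, true_and, Finset.mem_Ico]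
    rcases Nat.lt_or_ge y (a 0) with hy | hy
    · have := low y hy y.2
      have e : (⟨(y : ℕ), y.2⟩ : Fin (N+1)) = y := rfl
      rw [e] at this
      rw [this]
      constructor
      · intro h
        exact absurd h.symm (Fin.castSucc_lt_last i).ne
      · rintro ⟨h, _⟩
        have := hmin i.castSucc
        rw [Fin.le_def] at h this
        omega
    · have u1 := up y hy y.2 i.castSucc
      have u2 := up y hy y.2 i.succ
      have e : (⟨(y : ℕ), y.2⟩ : Fin (N+1)) = y := rfl
      rw [e, Fin.le_def] at u1 u2
      rw [Fin.le_def, Fin.lt_def, Fin.ext_iff]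
      simp at u1 u2 ⊢
      omega
  rw [hset, Fin.card_Ico]
  have := (up (a i.succ) (by have := hmin i.succ; rw [Fin.le_def] at this; exact this)
    (a i.succ).2 i.castSucc).1 (by
      have e : (⟨(a i.succ : ℕ), (a i.succ).2⟩ : Fin (N+1)) = a i.succ := rfl
      rw [e, hca]
      rw [Fin.le_def]; simp)
  omega

open Finset Fin.NatCast in
lemma key_step (k m N : ℕ) (hN : N = k * (m + 1)) (a : Fin (k+1) → Fin (N+1))
    (hinj : Function.Injective a) (hmin : ∀ i, a 0 ≤ a i)
    (gs : List (Equiv.Perm (Fin (N+1)))) (hlen : gs.length = m)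
    (hgs : ∀ g ∈ gs, g.support.card ≤ k + 1)
    (hprod : (List.ofFn a).formPerm * gs.prod = finRotate (N+1)) (i : Fin k) :
    ∃ d : ℕ, (a i.succ : ℕ) = a i.castSucc + 1 + k * d := by
  classical
  set τ := (List.ofFn a).formPerm with hτ
  have hnd : (List.ofFn a).Nodup := List.nodup_ofFn.2 hinj
  have τsucc : ∀ i : Fin k, τ (a i.castSucc) = a i.succ := by
    intro i
    have := List.formPerm_apply_getElem (List.ofFn a) hnd i.1 (by simp)
    simp only [List.getElem_ofFn, List.length_ofFn] at this
    rw [hτ]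
    rw [show i.castSucc = (⟨i.1, by omega⟩ : Fin (k+1)) from rfl, this]
    congr 1
    ext
    simp only [Fin.val_succ]
    rw [Nat.mod_eq_of_lt (by omega)]
  have τout : ∀ x, (∀ i, a i ≠ x) → τ x = x := by
    intro x hx
    apply List.formPerm_apply_of_notMem
    rw [List.mem_ofFn]
    rintro ⟨i, hi⟩
    exact hx i hi
  have τlast : τ (a (Fin.last k)) = a 0 := by
    have := List.formPerm_apply_getElem (List.ofFn a) hnd k (by simp)
    simp only [List.getElem_ofFn, List.length_ofFn] at this
    rw [hτ]
    rw [show Fin.last k = (⟨k, by omega⟩ : Fin (k+1)) from rfl, this]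
    congr 1
    ext
    simp
  let E : Fin gs.length → Finset (Fin (N+1)) := fun j => (gs.get j).support
  let r : Fin (N+1) → Fin (N+1) → Prop := fun x y => ∃ j, x ∈ E j ∧ y ∈ E j
  let Q := Quot r
  let q : Fin (N+1) → Q := Quot.mk r
  have : Finite Q := Quot.finite r
  letI : Fintype Q := Fintype.ofFinite Q
  have hqs : Function.Surjective q := Quot.mk_surjective
  have hq : ∀ j, ∀ x ∈ E j, ∀ y ∈ E j, q x = q y := fun j x hx y hy =>
    Quot.sound ⟨j, hx, hy⟩
  have hconn : ∀ T : Finset (Fin (N+1)), (∀ j, ∀ x ∈ E j, ∀ y ∈ E j, x ∈ T → y ∈ T) →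
      ∀ x y, q x = q y → x ∈ T → y ∈ T := by
    intro T hT x y hxy hx
    have := congrArg (Quot.lift (fun z => z ∈ T) (by
      rintro u v ⟨j, hu, hv⟩
      exact propext ⟨hT j u hu v hv, hT j v hv u hu⟩)) hxy
    exact this.mp hx
  have hπ : ∀ l : List (Equiv.Perm (Fin (N+1))), (∀ g ∈ l, g ∈ gs) → ∀ x, q (l.prod x) = q x := by
    intro l
    induction l with
    | nil => intro _ x; simp
    | cons g l ih =>
      intro h x
      rw [List.prod_cons, Equiv.Perm.mul_apply, ← ih (fun g hg => h g (by simp [hg])) x]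
      generalize l.prod x = z
      by_cases hz : g z = z
      · rw [hz]
      · obtain ⟨j, hj, hjg⟩ := List.getElem_of_mem (h g (by simp))
        apply hq ⟨j, hj⟩ <;> simp only [E, List.get_eq_getElem, hjg] <;>
          simp [Equiv.Perm.mem_support, hz]
  have hπ := hπ gs (fun _ h => h)
  have hσ : ∀ x, τ (gs.prod x) = x + 1 := by
    intro x
    rw [← Equiv.Perm.mul_apply, hprod, finRotate_apply]
  have hsurj : Function.Surjective (fun i => q (a i)) := by
    intro c
    by_contra hno
    push Not at hno
    obtain ⟨x, hx⟩ := hqs c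
    have step : ∀ y, q y = c → q (y+1) = c := by
      intro y hy
      rw [← hσ y, τout, hπ, hy]
      intro i hi
      apply hno i
      show q (a i) = c
      rw [hi, hπ, hy]
    have all : ∀ t : ℕ, q (x + (t : Fin (N+1))) = c := by
      intro t
      induction t with
      | zero => simpa using hx
      | succ t ih =>
        have := step _ ih
        rw [add_assoc] at this
        exact_mod_cast this
    apply hno 0
    have := all ((a 0 - x : Fin (N+1)) : ℕ)
    simpa using this
  have hE : ∀ j, (E j).card ≤ k + 1 := fun j => hgs _ (List.get_mem _ _)
  have hQ : Fintype.card Q ≤ k + 1 := by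
    simpa using Fintype.card_le_of_surjective _ hsurj
  obtain ⟨hcard, hm⟩ := hypertree_count k E hE q hqs hq hconn (by
    simp [hlen, hN]; ring) hQ
  have hbij : Function.Bijective (fun i => q (a i)) :=
    (Fintype.bijective_iff_surjective_and_card _).2 ⟨hsurj, by simp [hcard]⟩
  let e := Equiv.ofBijective _ hbij
  have he : ∀ i, e i = q (a i) := fun i => rfl
  have hlab := circle_labels k N a hinj hmin (fun x => e.symm (q x))
    (fun i => by rw [Equiv.symm_apply_eq, he])
    (by
      intro x hx
      have : gs.prod x = x + 1 := by
        apply τ.injective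
        rw [hσ, τout _ hx]
      simp only [← this, hπ])
    (by
      intro x i hi
      have : gs.prod x = a i.castSucc := by
        apply τ.injective
        rw [hσ, τsucc, hi]
      rw [Equiv.symm_apply_eq, he, ← this, hπ]) i
  obtain ⟨d, hd⟩ := hm (e i.castSucc)
  refine ⟨d, ?_⟩
  rw [hlab]
  have : (univ.filter (fun y => e.symm (q y) = i.castSucc)) =
      univ.filter (fun y => q y = e i.castSucc) := by
    ext y
    simp [Equiv.symm_apply_eq]
  rw [this, hd, add_assoc]

lemma factor_step {n k : ℕ} (f : MinKFact n k) (j : Fin n) (i : Fin k) :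
    ∃ d : ℕ, (f.a j i.succ : ℕ) = f.a j i.castSucc + 1 + k * d := by
  have hp := f.prod_eq
  set l := (List.ofFn (fun j => (List.ofFn (f.a j)).formPerm)).reverse with hl
  have hmem : (List.ofFn (f.a j)).formPerm ∈ l := by
    rw [hl, List.mem_reverse, List.mem_ofFn]
    exact ⟨j, rfl⟩
  have hsupp : ∀ g ∈ l, g.support.card ≤ k + 1 := by
    intro g hg
    rw [hl, List.mem_reverse, List.mem_ofFn] at hg
    obtain ⟨j, rfl⟩ := hg
    calc _ ≤ (List.ofFn (f.a j)).toFinset.card :=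
          Finset.card_le_card (List.support_formPerm_le _)
      _ ≤ _ := List.toFinset_card_le _
      _ = _ := by simp
  have hlen : l.length = n := by simp [hl]
  obtain ⟨s, t, hst⟩ := List.append_of_mem hmem
  set τ := (List.ofFn (f.a j)).formPerm with hτ
  refine key_step k (n-1) (k*n) ?_ (f.a j) (f.inj j) (f.min_first j)
    (s.map (MulAut.conj τ⁻¹) ++ t) ?_ ?_ ?_ i
  · rw [Nat.sub_add_cancel]
    have := j.2
    omega
  · rw [hst] at hlen
    simp at hlen ⊢
    omega
  · intro g hg
    rw [List.mem_append, List.mem_map] at hg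
    rcases hg with ⟨g, hg, rfl⟩ | hg
    · rw [MulAut.conj_apply, Equiv.Perm.card_support_conj]
      exact hsupp g (by rw [hst]; simp [hg])
    · exact hsupp g (by rw [hst]; simp [hg])
  · rw [← hp, hst]
    rw [List.prod_append, List.prod_append, List.prod_cons, ← map_list_prod, MulAut.conj_apply, ← hτ]
    clear_value τ
    group

lemma factor_mod {n k : ℕ} (f : MinKFact n k) (j : Fin n) (i : Fin (k+1)) :
    ∃ d : ℕ, (f.a j i : ℕ) = f.a j 0 + i + k * d := by
  induction i using Fin.induction with
  | zero => exact ⟨0, by simp⟩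
  | succ i ih =>
    obtain ⟨d, hd⟩ := ih
    obtain ⟨d', hd'⟩ := factor_step f j i
    refine ⟨d + d', ?_⟩
    rw [hd', hd]
    simp
    ring

lemma sum_fin_cast (k : ℕ) : ∑ i : Fin k, ((i : ℕ) : ℤ) = (k.choose 2 : ℤ) := by
  rw [Fin.sum_univ_eq_sum_range (fun i => (i : ℤ)) k, ← Nat.cast_sum, Finset.sum_range_id,
    Nat.choose_two_right]

lemma choose_diff (n k : ℕ) :
    ((k*n).choose 2 : ℤ) = n * (k.choose 2 : ℤ) + k * (k * (n.choose 2 : ℤ)) := by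
  have h : ∀ m : ℕ, (m.choose 2 : ℚ) = m * (m - 1) / 2 := fun m => Nat.cast_choose_two ℚ m
  have : ((k*n).choose 2 : ℚ) = n * (k.choose 2 : ℚ) + k * (k * (n.choose 2 : ℚ)) := by
    rw [h, h, h]
    push_cast
    ring
  exact_mod_cast this

/-- For all `n, k ≥ 1` and every minimal `k`-factorization `f ∈ F_n^k`,
both `semiarea_k f` and `cosemiarea_k f` are divisible by `k`. -/
theorem stmt16 (n k : ℕ) (hn : 1 ≤ n) (hk : 1 ≤ k) (f : MinKFact n k) :
    (k : ℤ) ∣ MinKFact.semiareak f ∧ (k : ℤ) ∣ MinKFact.cosemiareak f := by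
  choose d hd using factor_mod f
  have hd' : ∀ j i, ((f.a j i : ℕ) : ℤ) = (f.a j 0 : ℕ) + (i : ℕ) + k * d j i := by
    intro j i
    exact_mod_cast hd j i
  unfold MinKFact.semiareak MinKFact.cosemiareak
  rw [choose_diff]
  constructor
  · have : ∑ i : Fin k, ∑ j : Fin n, ((f.a j i.castSucc : ℕ) : ℤ) =
        k * (∑ j : Fin n, ((f.a j 0 : ℕ) : ℤ)) + n * (k.choose 2 : ℤ) +
          k * ∑ i : Fin k, ∑ j : Fin n, (d j i.castSucc : ℤ) := by
      simp_rw [hd' _ (Fin.castSucc _), Finset.sum_add_distrib, ← Finset.mul_sum]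
      simp [← Finset.mul_sum, sum_fin_cast]
    rw [this]
    refine ⟨k * (n.choose 2 : ℤ) - (∑ j : Fin n, ((f.a j 0 : ℕ) : ℤ)) -
      ∑ i : Fin k, ∑ j : Fin n, (d j i.castSucc : ℤ), ?_⟩
    ring
  · have : ∑ i : Fin k, ∑ j : Fin n, (((f.a j i.succ : ℕ) : ℤ) - 1) =
        k * (∑ j : Fin n, ((f.a j 0 : ℕ) : ℤ)) + n * (k.choose 2 : ℤ) +
          k * ∑ i : Fin k, ∑ j : Fin n, (d j i.succ : ℤ) := by
      have e : ∀ j (i : Fin k), ((f.a j i.succ : ℕ) : ℤ) - 1 =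
          (f.a j 0 : ℕ) + (i : ℕ) + k * d j i.succ := by
        intro j i
        rw [hd' j i.succ]
        simp
        ring
      simp_rw [e, Finset.sum_add_distrib, ← Finset.mul_sum]
      simp [← Finset.mul_sum, sum_fin_cast]
    rw [this]
    refine ⟨(∑ j : Fin n, ((f.a j 0 : ℕ) : ℤ)) +
      (∑ i : Fin k, ∑ j : Fin n, (d j i.succ : ℤ)) - k * (n.choose 2 : ℤ), ?_⟩
    ring
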